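/- arXiv:1806.06579 — 2 statements merged into one kernel-verified Lean document; each statement's English description precedes it below -/
import Mathlib

section
/- Let n_p, n_nr, n_r be natural numbers and let P be a symmetric positive-definite real matrix of size (n_p + n_nr + n_r) × (n_p + n_nr + n_r), partitioned conformally into blocks indexed by the plant states, non-reset controller states, and reset states. Let C_p be a real 1×n_p row matrix, β ∈ ℝ^{n_r} a column vector, and P_ρ a symmetric positive-definite n_r×n_r matrix, and suppose the bottom block row of P satisfies B₀ᵀ·P = C₀, i.e. the (reset, plant) block of P equals β·C_p, the (reset, non-reset) block of P equals 0, and the (reset, reset) block of P equals P_ρ. Let A_ρ be the block-diagonal matrix diag(I_{n_p}, I_{n_nr}, 0_{n_r}) (which zeroes the reset states). Then for every x = (x_p, x_nr, x_r) with C_p·x_p = 0 (i.e. on the reset surface where the error is zero), (A_ρ·x)ᵀ·P·(A_ρ·x) − xᵀ·P·x = −x_rᵀ·P_ρ·x_r ≤ 0. -/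
open Matrix

/-- The structural condition `B₀ᵀ·P = C₀` of the restricted Lyapunov equation
(bottom block row of `P` equal to `[β·C_p, 0, P_ρ]`) implies the jump condition
`V(A_ρ x) − V(x) = −x_rᵀ·P_ρ·x_r ≤ 0` on the reset surface `C_p·x_p = 0`,
where `A_ρ = diag(I, I, 0)` zeroes the reset states. -/
theorem restricted_lyapunov_jump_condition
    (np nnr nr : ℕ)
    (P : Matrix (Fin np ⊕ (Fin nnr ⊕ Fin nr)) (Fin np ⊕ (Fin nnr ⊕ Fin nr)) ℝ)
    (hPsymm : P.IsSymm) (hPpos : P.PosDef)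
    (Cp : Matrix (Fin 1) (Fin np) ℝ) (β : Fin nr → ℝ)
    (Pρ : Matrix (Fin nr) (Fin nr) ℝ) (hPρsymm : Pρ.IsSymm) (hPρpos : Pρ.PosDef)
    (hrp : ∀ (k : Fin nr) (i : Fin np),
      P (Sum.inr (Sum.inr k)) (Sum.inl i) = β k * Cp 0 i)
    (hrn : ∀ (k : Fin nr) (j : Fin nnr),
      P (Sum.inr (Sum.inr k)) (Sum.inr (Sum.inl j)) = 0)
    (hrr : ∀ (k k' : Fin nr),
      P (Sum.inr (Sum.inr k)) (Sum.inr (Sum.inr k')) = Pρ k k')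
    (Aρ : Matrix (Fin np ⊕ (Fin nnr ⊕ Fin nr)) (Fin np ⊕ (Fin nnr ⊕ Fin nr)) ℝ)
    (hAρ : Aρ = Matrix.fromBlocks (1 : Matrix (Fin np) (Fin np) ℝ) 0 0
      (Matrix.fromBlocks (1 : Matrix (Fin nnr) (Fin nnr) ℝ) 0 0
        (0 : Matrix (Fin nr) (Fin nr) ℝ)))
    (x : Fin np ⊕ (Fin nnr ⊕ Fin nr) → ℝ)
    (hx : Cp.mulVec (fun i => x (Sum.inl i)) 0 = 0) :
    (Aρ.mulVec x) ⬝ᵥ P.mulVec (Aρ.mulVec x) - x ⬝ᵥ P.mulVec x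
      = -((fun k => x (Sum.inr (Sum.inr k))) ⬝ᵥ
          Pρ.mulVec (fun k => x (Sum.inr (Sum.inr k)))) ∧
    (Aρ.mulVec x) ⬝ᵥ P.mulVec (Aρ.mulVec x) - x ⬝ᵥ P.mulVec x ≤ 0 := by
  have hy : Aρ.mulVec x = Sum.elim (fun i => x (Sum.inl i))
      (Sum.elim (fun j => x (Sum.inr (Sum.inl j))) (fun _ => 0)) := by
    subst hAρ
    funext i
    rcases i with i | i | i <;>
      simp [Matrix.mulVec, dotProduct, Fintype.sum_sum_type, Matrix.one_apply]
  set y := Aρ.mulVec x with hydef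
  set xr : Fin nr → ℝ := fun k => x (Sum.inr (Sum.inr k)) with hxr
  let r : Fin np ⊕ (Fin nnr ⊕ Fin nr) → ℝ :=
    Sum.elim (fun _ => 0) (Sum.elim (fun _ => 0) xr)
  have hsum : x = y + r := by
    rw [hy]
    funext i
    rcases i with i | i | i <;> simp [r, hxr]
  have hdot : ∀ v : Fin np ⊕ (Fin nnr ⊕ Fin nr) → ℝ,
      r ⬝ᵥ v = xr ⬝ᵥ (fun k => v (Sum.inr (Sum.inr k))) := by
    intro v
    simp [r, dotProduct, Fintype.sum_sum_type]
  have hPy : ∀ k, P.mulVec y (Sum.inr (Sum.inr k)) = 0 := by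
    intro k
    have hx' : ∑ i, Cp 0 i * x (Sum.inl i) = 0 := hx
    rw [hy]
    simp only [Matrix.mulVec, dotProduct, Fintype.sum_sum_type, Sum.elim_inl, Sum.elim_inr,
      hrp, hrn, zero_mul, mul_zero, Finset.sum_const_zero, add_zero, mul_assoc]
    rw [← Finset.mul_sum, hx', mul_zero]
  have hPr : ∀ k, P.mulVec r (Sum.inr (Sum.inr k)) = Pρ.mulVec xr k := by
    intro k
    simp [r, Matrix.mulVec, dotProduct, Fintype.sum_sum_type, hrr]
  have h1 : r ⬝ᵥ P.mulVec y = 0 := by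
    rw [hdot]
    simp [hPy, dotProduct]
  have h2 : r ⬝ᵥ P.mulVec r = xr ⬝ᵥ Pρ.mulVec xr := by
    rw [hdot]
    simp only [hPr]
  have h3 : y ⬝ᵥ P.mulVec r = 0 := by
    rw [Matrix.dotProduct_mulVec, ← Matrix.mulVec_transpose, hPsymm.eq, dotProduct_comm, h1]
  have hquad : x ⬝ᵥ P.mulVec x = y ⬝ᵥ P.mulVec y + xr ⬝ᵥ Pρ.mulVec xr := by
    have e : x ⬝ᵥ P.mulVec x = (y + r) ⬝ᵥ P.mulVec (y + r) := by rw [← hsum]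
    rw [e, Matrix.mulVec_add, add_dotProduct, dotProduct_add, dotProduct_add, h1, h2, h3]
    ring
  have hnn : 0 ≤ xr ⬝ᵥ Pρ.mulVec xr := by
    simpa using hPρpos.posSemidef.dotProduct_mulVec_nonneg xr
  rw [hquad]
  constructor
  · ring
  · linarith
end

section
/- Let ω_r, ω_{rα}, ω_f, ζ_r be positive reals and consider the 4×4 real matrix A_r with rows [0, 1, 0, 0], [−ω_r², −2ζ_r·ω_r, 0, 0], [0, 0, 0, 1], [1, 0, −ω_f², −2ω_f], the column vector B_r = (0, ω_r², 0, 0)ᵀ, the row vector C_r = [ω_f²/ω_{rα}², 0, ω_f² − ω_f⁴/ω_{rα}², 2ω_f²·ζ_r/ω_{rα} − 2ω_f³/ω_{rα}²], and D_r = 0. Then for every s ∈ ℂ for which s·I − A_r is invertible (equivalently, (s² + 2ζ_r·ω_r·s + ω_r²)·(s² + 2ω_f·s + ω_f²) ≠ 0), the transfer function C_r·(s·I − A_r)⁻¹·B_r + D_r equals R(s)·L(s), where R(s) = 1/((s/ω_r)² + 2ζ_r·(s/ω_r) + 1) and L(s) = ((s/ω_{rα})² + 2ζ_r·(s/ω_{rα})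 + 1)/((s/ω_f)² + 2·(s/ω_f) + 1). -/
open Matrix

/-- Correctness of the paper's 4-state realization of the base linear system of the
CgLp element: the transfer function `C_r·(sI − A_r)⁻¹·B_r + D_r` equals
`R(s)·L(s)` with `R(s) = 1/((s/ω_r)² + 2ζ_r(s/ω_r) + 1)` and
`L(s) = ((s/ω_{rα})² + 2ζ_r(s/ω_{rα}) + 1)/((s/ω_f)² + 2(s/ω_f) + 1)`, at every
`s` where `sI − A_r` is invertible, i.e. where
`(s² + 2ζ_rω_r s + ω_r²)(s² + 2ω_f s + ω_f²) ≠ 0`. -/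
theorem cglp_state_space_transfer_function (ωr ωrα ωf ζr : ℝ)
    (hωr : 0 < ωr) (hωrα : 0 < ωrα) (hωf : 0 < ωf) (hζr : 0 < ζr)
    (Ar : Matrix (Fin 4) (Fin 4) ℂ)
    (hAr : Ar = !![0, 1, 0, 0;
                   -(ωr : ℂ) ^ 2, -(2 * (ζr : ℂ) * (ωr : ℂ)), 0, 0;
                   0, 0, 0, 1;
                   1, 0, -(ωf : ℂ) ^ 2, -(2 * (ωf : ℂ))])
    (Br : Fin 4 → ℂ) (hBr : Br = ![0, (ωr : ℂ) ^ 2, 0, 0])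
    (Cr : Fin 4 → ℂ)
    (hCr : Cr = ![(ωf : ℂ) ^ 2 / (ωrα : ℂ) ^ 2, 0,
                  (ωf : ℂ) ^ 2 - (ωf : ℂ) ^ 4 / (ωrα : ℂ) ^ 2,
                  2 * (ωf : ℂ) ^ 2 * (ζr : ℂ) / (ωrα : ℂ)
                    - 2 * (ωf : ℂ) ^ 3 / (ωrα : ℂ) ^ 2])
    (Dr : ℂ) (hDr : Dr = 0) :
    ∀ s : ℂ,
      (IsUnit (s • (1 : Matrix (Fin 4) (Fin 4) ℂ) - Ar)
        ↔ (s ^ 2 + 2 * (ζr : ℂ) * (ωr : ℂ) * s + (ωr : ℂ) ^ 2)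
            * (s ^ 2 + 2 * (ωf : ℂ) * s + (ωf : ℂ) ^ 2) ≠ 0) ∧
      ((s ^ 2 + 2 * (ζr : ℂ) * (ωr : ℂ) * s + (ωr : ℂ) ^ 2)
          * (s ^ 2 + 2 * (ωf : ℂ) * s + (ωf : ℂ) ^ 2) ≠ 0 →
        Cr ⬝ᵥ ((s • (1 : Matrix (Fin 4) (Fin 4) ℂ) - Ar)⁻¹).mulVec Br + Dr
          = (1 / ((s / (ωr : ℂ)) ^ 2 + 2 * (ζr : ℂ) * (s / (ωr : ℂ)) + 1))
            * (((s / (ωrα : ℂ)) ^ 2 + 2 * (ζr : ℂ) * (s / (ωrα : ℂ)) + 1)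
              / ((s / (ωf : ℂ)) ^ 2 + 2 * (s / (ωf : ℂ)) + 1))) := by
  intro s
  have h1 : (ωr : ℂ) ≠ 0 := by exact_mod_cast hωr.ne'
  have h2 : (ωrα : ℂ) ≠ 0 := by exact_mod_cast hωrα.ne'
  have h3 : (ωf : ℂ) ≠ 0 := by exact_mod_cast hωf.ne'
  generalize (ωr : ℂ) = a at *
  generalize (ωrα : ℂ) = b at *
  generalize (ωf : ℂ) = f at *
  generalize (ζr : ℂ) = z at *
  have hM : s • (1 : Matrix (Fin 4) (Fin 4) ℂ) - Ar =
      !![s, -1, 0, 0; a ^ 2, s + 2 * z * a, 0, 0; 0, 0, s, -1; -1, 0, f ^ 2, s + 2 * f] := by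
    subst hAr
    ext i j
    fin_cases i <;> fin_cases j <;> simp
  have hdet : (s • (1 : Matrix (Fin 4) (Fin 4) ℂ) - Ar).det =
      (s ^ 2 + 2 * z * a * s + a ^ 2) * (s ^ 2 + 2 * f * s + f ^ 2) := by
    rw [hM]
    simp [Matrix.det_succ_row_zero, Fin.sum_univ_succ, Fin.succAbove]
    ring
  have hiff : IsUnit (s • (1 : Matrix (Fin 4) (Fin 4) ℂ) - Ar) ↔
      (s ^ 2 + 2 * z * a * s + a ^ 2) * (s ^ 2 + 2 * f * s + f ^ 2) ≠ 0 := by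
    rw [Matrix.isUnit_iff_isUnit_det, hdet, isUnit_iff_ne_zero]
  refine ⟨hiff, fun h => ?_⟩
  have hu : IsUnit (s • (1 : Matrix (Fin 4) (Fin 4) ℂ) - Ar).det :=
    (Matrix.isUnit_iff_isUnit_det _).1 (hiff.2 h)
  obtain ⟨hP, hQ⟩ := mul_ne_zero_iff.1 h
  obtain ⟨P, hPd⟩ : ∃ P, P = s ^ 2 + 2 * z * a * s + a ^ 2 := ⟨_, rfl⟩
  obtain ⟨Q, hQd⟩ : ∃ Q, Q = s ^ 2 + 2 * f * s + f ^ 2 := ⟨_, rfl⟩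
  rw [← hPd] at hP
  rw [← hQd] at hQ
  have hv : (s • (1 : Matrix (Fin 4) (Fin 4) ℂ) - Ar).mulVec
      ![a ^ 2 / P, s * (a ^ 2 / P), a ^ 2 / P / Q, s * (a ^ 2 / P / Q)] = Br := by
    rw [hM, hBr]
    ext i
    fin_cases i <;> simp [Matrix.mulVec, dotProduct, Fin.sum_univ_succ]
    · field_simp
      rw [hPd]; ring
    · field_simp
      rw [hQd]; ring
  have hinv : ((s • (1 : Matrix (Fin 4) (Fin 4) ℂ) - Ar)⁻¹).mulVec Br =
      ![a ^ 2 / P, s * (a ^ 2 / P), a ^ 2 / P / Q, s * (a ^ 2 / P / Q)] := by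
    rw [← hv, Matrix.mulVec_mulVec, Matrix.nonsing_inv_mul _ hu, Matrix.one_mulVec]
  have e1 : (s / a) ^ 2 + 2 * z * (s / a) + 1 = P / a ^ 2 := by
    rw [hPd]; field_simp
  have e2 : (s / f) ^ 2 + 2 * (s / f) + 1 = Q / f ^ 2 := by
    rw [hQd]; field_simp
  rw [hinv, e1, e2, hCr, hDr]
  simp [dotProduct, Fin.sum_univ_succ]
  field_simp
  rw [hQd]; ring
end
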